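/- Let n ≥ 7 and let f be a folding instruction set. Then 4·φ(n) ≤ S_f(n) ≤ 6·φ(n); moreover S_f(n) ∈ {4·φ(n), 6·φ(n)}. -/

import Mathlib

/-- A folding instruction set: a sequence with values in {-1, 1}. -/
def FoldingSeq (f : ℕ → ℤ) : Prop := ∀ s, f s = 1 ∨ f s = -1

/-- The paper-folding sequence `P_f`: if `k = 2^s * r` with `r` odd, then
`P_f[k] = f s` if `r ≡ 1 [MOD 4]` and `P_f[k] = -f s` if `r ≡ 3 [MOD 4]`. -/
def PF (f : ℕ → ℤ) (k : ℕ) : ℤ :=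
  if (k / 2 ^ (padicValNat 2 k)) % 4 = 1 then f (padicValNat 2 k)
  else -f (padicValNat 2 k)

/-- The length-`n` factors of `P_f` starting at indices `i` and `j` are identical. -/
def FactorMatch (f : ℕ → ℤ) (n i j : ℕ) : Prop :=
  ∀ t, t < n → PF f (i + t) = PF f (j + t)

/-- `Sf f n` : the least positive integer `m` such that every length-`n` factor of `P_f`
starts somewhere within the first `m` positions. -/
noncomputable def Sf (f : ℕ → ℤ) (n : ℕ) : ℕ :=
  sInf {m | 1 ≤ m ∧ ∀ i, 1 ≤ i → ∃ j, 1 ≤ j ∧ j ≤ m ∧ FactorMatch f n i j}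

/-- `Af f n` : the least positive integer `m` such that every length-`n` factor of `P_f`
appears entirely within the prefix `P_f[1..m]`. -/
noncomputable def Af (f : ℕ → ℤ) (n : ℕ) : ℕ :=
  sInf {m | 1 ≤ m ∧ ∀ i, 1 ≤ i → ∃ j, 1 ≤ j ∧ j + n - 1 ≤ m ∧ FactorMatch f n i j}

/-- `phi2 n` : the least power of 2 that is `≥ n`, i.e. `2 ^ ⌈log₂ n⌉`. -/
def phi2 (n : ℕ) : ℕ := 2 ^ Nat.clog 2 n

/-- The value of the paper-folding sequence at `2 ^ s * r` with `r` odd. -/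
theorem PF_two_pow_mul (f : ℕ → ℤ) (s r : ℕ) (hr : r % 2 = 1) :
    PF f (2 ^ s * r) = if r % 4 = 1 then f s else -f s := by
  have hv : padicValNat 2 (2 ^ s * r) = s := by
    rw [padicValNat.mul (by positivity) (by omega), padicValNat.prime_pow,
      padicValNat.eq_zero_of_not_dvd (by omega), add_zero]
  rw [PF, hv, Nat.mul_div_cancel_left _ (by positivity)]

/-- Away from the multiples of `2 ^ s`, the paper-folding sequence has period `2 ^ (s + 1)`. -/
theorem PF_eq_of_modEq (f : ℕ → ℤ) {s k l : ℕ} (hk : ¬ 2 ^ s ∣ k)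
    (hkl : k ≡ l [MOD 2 ^ (s + 1)]) : PF f k = PF f l := by
  have hk0 : k ≠ 0 := by rintro rfl; exact hk (dvd_zero _)
  obtain ⟨v, r, hr, rfl⟩ := Nat.exists_eq_two_pow_mul_odd hk0
  have hvs : v < s := by
    by_contra! h
    exact hk ((pow_dvd_pow 2 h).mul_right r)
  have hmod : 2 ^ v * r ≡ l [MOD 2 ^ v * 4] := by
    refine hkl.of_dvd ?_
    rw [show (4 : ℕ) = 2 ^ 2 by norm_num, ← pow_add]
    exact pow_dvd_pow 2 (by omega)
  obtain ⟨r', rfl⟩ : 2 ^ v ∣ l :=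
    ((hmod.of_dvd (dvd_mul_right _ _)).dvd_iff dvd_rfl).1 (dvd_mul_right _ _)
  have hrr : r % 4 = r' % 4 := Nat.ModEq.mul_left_cancel' (by positivity) hmod
  have hr2 : r % 2 = 1 := Nat.odd_iff.1 hr
  rw [PF_two_pow_mul f v r hr2, PF_two_pow_mul f v r' (by omega), hrr]

/-- If `i` is divisible by `2 ^ (a + 1)` with `3 ≤ a`, then so is every index at which the factor
starting at `i` of length more than `2 ^ (a - 1)` and at least `7` occurs. -/
theorem FactorMatch.two_pow_dvd {f : ℕ → ℤ} (hf : FoldingSeq f) {n i j a : ℕ} (ha : 3 ≤ a)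
    (hn : 7 ≤ n) (han : 2 ^ (a - 1) < n) (hi : 2 ^ (a + 1) ∣ i) (h : FactorMatch f n i j) :
    2 ^ (a + 1) ∣ j := by
  have hne : ∀ s, f s ≠ -f s := fun s => by rcases hf s with h | h <;> rw [h] <;> norm_num
  suffices H : ∀ b, b ≤ a → 2 ^ (b + 1) ∣ j from H a le_rfl
  intro b
  induction b with
  | zero =>
    intro _
    by_contra hj
    have hi8 : 8 ∣ i := (pow_dvd_pow 2 (show 3 ≤ a + 1 by omega)).trans hi
    obtain ⟨c, rfl⟩ := hi8
    have h2 := h 2 (by omega)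
    have h6 := h 6 (by omega)
    have e : PF f (j + 2) = PF f (j + 6) := by
      refine PF_eq_of_modEq f (s := 1) (by omega) ?_
      simp only [Nat.ModEq]
      omega
    have e2 : PF f (8 * c + 2) = f 1 := by
      rw [show 8 * c + 2 = 2 ^ 1 * (4 * c + 1) by ring, PF_two_pow_mul f 1 _ (by omega),
        if_pos (by omega)]
    have e6 : PF f (8 * c + 6) = -f 1 := by
      rw [show 8 * c + 6 = 2 ^ 1 * (4 * c + 3) by ring, PF_two_pow_mul f 1 _ (by omega),
        if_neg (by omega)]
    exact hne 1 (e2.symm.trans (h2.trans (e.trans (h6.symm.trans e6))))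
  | succ b ih =>
    intro hb
    obtain ⟨d, rfl⟩ := ih (by omega)
    obtain ⟨c, rfl⟩ := (pow_dvd_pow 2 (show b + 2 ≤ a + 1 by omega)).trans hi
    have ht := h (2 ^ b) ((Nat.pow_le_pow_right (by norm_num) (by omega)).trans_lt han)
    rw [show 2 ^ (b + 2) * c + 2 ^ b = 2 ^ b * (4 * c + 1) by ring,
      show 2 ^ (b + 1) * d + 2 ^ b = 2 ^ b * (2 * d + 1) by ring,
      PF_two_pow_mul f b _ (by omega), PF_two_pow_mul f b _ (by omega),
      if_pos (by omega)] at ht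
    have hd : 2 ∣ d := by
      by_contra hd
      rw [if_neg (by omega)] at ht
      exact hne b ht
    rw [pow_succ]
    exact mul_dvd_mul_left _ hd

/-- Factors of length at most `2 ^ a` that contain multiples `2 ^ (a + 1) * m`, `2 ^ (a + 1) * m'`
at the same offset agree as soon as the sequence agrees at these two multiples. -/
theorem factorMatch_of_PF_eq (f : ℕ → ℤ) {n a i j t₀ m m' : ℕ} (hn : n ≤ 2 ^ a) (ht₀ : t₀ < n)
    (hi : i + t₀ = 2 ^ (a + 1) * m) (hj : j + t₀ = 2 ^ (a + 1) * m')
    (h : PF f (2 ^ (a + 1) * m) = PF f (2 ^ (a + 1) * m')) : FactorMatch f n i j := by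
  intro t ht
  obtain rfl | hne := eq_or_ne t t₀
  · rw [hi, hj, h]
  · refine PF_eq_of_modEq f (s := a) ?_ ?_
    · rintro ⟨c, hc⟩
      have hz : ((2 ^ a : ℕ) : ℤ) ∣ (t : ℤ) - t₀ := by
        refine ⟨(c : ℤ) - 2 * m, ?_⟩
        rw [pow_succ] at hi
        zify at hi hc ⊢
        linear_combination hc - hi
      have := Int.eq_zero_of_abs_lt_dvd hz (by rw [abs_lt]; omega)
      omega
    · refine Nat.ModEq.add_right t (Nat.ModEq.add_right_cancel' t₀ ?_)
      rw [hi, hj]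
      exact ((Nat.modEq_zero_iff_dvd.2 (dvd_mul_right _ _)).trans
        (Nat.modEq_zero_iff_dvd.2 (dvd_mul_right _ _)).symm)

/-- If both values occur in the paper-folding sequence at positions `2 ^ (a + 1) * m` with
`1 ≤ m ≤ M`, where `2 ≤ M`, then all factors of length at most `2 ^ a` start within the first
`2 ^ (a + 1) * M` positions. -/
theorem exists_factorMatch_le (f : ℕ → ℤ) {n a M : ℕ} (hn : n ≤ 2 ^ a) (hM : 2 ≤ M)
    (h : ∀ m, 1 ≤ m → ∃ m', 1 ≤ m' ∧ m' ≤ M ∧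
      PF f (2 ^ (a + 1) * m) = PF f (2 ^ (a + 1) * m')) {i : ℕ} (hi : 1 ≤ i) :
    ∃ j, 1 ≤ j ∧ j ≤ 2 ^ (a + 1) * M ∧ FactorMatch f n i j := by
  have hpow : 2 ^ (a + 1) = 2 * 2 ^ a := by ring
  by_cases hdvd : ∃ t₀ < n, 2 ^ (a + 1) ∣ i + t₀
  · obtain ⟨t₀, ht₀, m, hm⟩ := hdvd
    have hm1 : 1 ≤ m := Nat.one_le_iff_ne_zero.2 (by rintro rfl; omega)
    obtain ⟨m', hm', hm'M, he⟩ := h m hm1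
    have hle : 2 ^ (a + 1) * 1 ≤ 2 ^ (a + 1) * m' := Nat.mul_le_mul_left _ hm'
    have hle' : 2 ^ (a + 1) * m' ≤ 2 ^ (a + 1) * M := Nat.mul_le_mul_left _ hm'M
    refine ⟨2 ^ (a + 1) * m' - t₀, by omega, by omega, ?_⟩
    exact factorMatch_of_PF_eq f hn ht₀ hm (by omega) he
  · push Not at hdvd
    have hle : 2 ^ (a + 1) * 2 ≤ 2 ^ (a + 1) * M := Nat.mul_le_mul_left _ hM
    refine ⟨(i - 1) % 2 ^ (a + 2) + 1, by omega, ?_, fun t ht => ?_⟩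
    · have := Nat.mod_lt (i - 1) (show 2 ^ (a + 2) > 0 by positivity)
      rw [pow_succ 2 (a + 1)] at *
      omega
    · refine PF_eq_of_modEq f (hdvd t ht) (Nat.ModEq.add_right t ?_)
      have := (Nat.mod_modEq (i - 1) (2 ^ (a + 2))).symm.add_right 1
      rwa [Nat.sub_add_cancel hi] at this

/-- If the value at `2 ^ (a + 1) * M` does not occur at smaller positive multiples of
`2 ^ (a + 1)`, but both values occur at multiples up to it, then `Sf f n = 2 ^ (a + 1) * M`. -/
theorem Sf_eq {f : ℕ → ℤ} (hf : FoldingSeq f) {n a M : ℕ} (ha : 3 ≤ a) (hn : 7 ≤ n)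
    (han : 2 ^ (a - 1) < n) (hna : n ≤ 2 ^ a) (hM : 2 ≤ M)
    (h : ∀ m, 1 ≤ m → ∃ m', 1 ≤ m' ∧ m' ≤ M ∧
      PF f (2 ^ (a + 1) * m) = PF f (2 ^ (a + 1) * m'))
    (hfirst : ∀ m, 1 ≤ m → m < M → PF f (2 ^ (a + 1) * M) ≠ PF f (2 ^ (a + 1) * m)) :
    Sf f n = 2 ^ (a + 1) * M := by
  have hpos : 1 ≤ 2 ^ (a + 1) * M := Nat.mul_pos (by positivity) (by omega)
  refine IsLeast.csInf_eq ⟨⟨hpos, fun i hi => exists_factorMatch_le f hna hM h hi⟩, ?_⟩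
  rintro m ⟨-, hm⟩
  obtain ⟨j, hj, hjm, hmatch⟩ := hm _ hpos
  obtain ⟨c, rfl⟩ := hmatch.two_pow_dvd hf ha hn han (dvd_mul_right _ _)
  refine le_trans (Nat.mul_le_mul_left _ ?_) hjm
  by_contra! hc
  have hc1 : 1 ≤ c := Nat.one_le_iff_ne_zero.2 (by rintro rfl; simp at hj)
  exact hfirst c hc1 hc (hmatch 0 (by omega))

/-- The values of a paper-folding sequence are `1` and `-1`. -/
theorem FoldingSeq.PF_eq {f : ℕ → ℤ} (hf : FoldingSeq f) (k : ℕ) : PF f k = 1 ∨ PF f k = -1 := by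
  unfold PF
  rcases hf (padicValNat 2 k) with h | h <;> split_ifs <;> simp [h]

theorem stmt7 (f : ℕ → ℤ) (hf : FoldingSeq f) (n : ℕ) (hn : 7 ≤ n) :
    4 * phi2 n ≤ Sf f n ∧ Sf f n ≤ 6 * phi2 n ∧
      (Sf f n = 4 * phi2 n ∨ Sf f n = 6 * phi2 n) := by
  set a := Nat.clog 2 n with ha_def
  have hna : n ≤ 2 ^ a := Nat.le_pow_clog (by norm_num) n
  have han : 2 ^ (a - 1) < n := Nat.pow_pred_clog_lt_self (by norm_num) (by omega)
  have ha : 3 ≤ a := by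
    by_contra! h
    have := Nat.pow_le_pow_right (show 0 < 2 by norm_num) (show a ≤ 2 by omega)
    omega
  have hphi : phi2 n = 2 ^ a := rfl
  have h1 : PF f (2 ^ (a + 1) * 1) = f (a + 1) := by
    rw [PF_two_pow_mul f _ _ (by norm_num), if_pos (by norm_num)]
  have h2 : PF f (2 ^ (a + 1) * 2) = f (a + 2) := by
    rw [show 2 ^ (a + 1) * 2 = 2 ^ (a + 2) * 1 by ring, PF_two_pow_mul f _ _ (by norm_num),
      if_pos (by norm_num)]
  have h3 : PF f (2 ^ (a + 1) * 3) = -f (a + 1) := by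
    rw [PF_two_pow_mul f _ _ (by norm_num), if_neg (by norm_num)]
  have hf1 := hf (a + 1)
  have hf2 := hf (a + 2)
  have hpow : 2 ^ (a + 1) = 2 * 2 ^ a := by ring
  by_cases heq : f (a + 1) = f (a + 2)
  · have hS : Sf f n = 2 ^ (a + 1) * 3 := by
      refine Sf_eq hf ha hn han hna (by norm_num) (fun m _ => ?_) (fun m hm hm3 => ?_)
      · have := hf.PF_eq (2 ^ (a + 1) * m)
        by_cases h : PF f (2 ^ (a + 1) * m) = f (a + 1)
        · exact ⟨1, le_rfl, by norm_num, h.trans h1.symm⟩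
        · exact ⟨3, by norm_num, le_rfl, by omega⟩
      · obtain rfl | rfl : m = 1 ∨ m = 2 := by omega
        all_goals omega
    omega
  · have hS : Sf f n = 2 ^ (a + 1) * 2 := by
      refine Sf_eq hf ha hn han hna le_rfl (fun m _ => ?_) (fun m hm hm2 => ?_)
      · have := hf.PF_eq (2 ^ (a + 1) * m)
        by_cases h : PF f (2 ^ (a + 1) * m) = f (a + 1)
        · exact ⟨1, le_rfl, by norm_num, h.trans h1.symm⟩
        · exact ⟨2, by norm_num, le_rfl, by omega⟩
      · obtain rfl : m = 1 := by omega
        omega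
    omega
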